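/- Let D be a discriminant form of exponent a power of an odd prime p and let γ ∈ D have order n with q(γ) = j/n mod 1, where either n ≤ p or p divides j. Then e^γ ∈ im(↑) if and only if γ^⊥ contains an isotropic subgroup isomorphic to (ℤ/pℤ)^2. -/

import Mathlib

open scoped Classical BigOperators

noncomputable section

/-- The bilinear form associated to a quadratic form `q : D → ℚ/ℤ`. -/
def bil {D : Type*} [AddCommGroup D] (q : D → AddCircle (1 : ℚ)) (x y : D) :
    AddCircle (1 : ℚ) :=
  q (x + y) - q x - q y

/-- The standard basis vector `e^γ` of `ℂ[D]`. -/
def eV {D : Type*} (γ : D) : D → ℂ := fun β => if β = γ then 1 else 0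

/-- `↑_H(e^{γ+H}) = ∑_{μ ∈ H} e^{γ+μ}`, as an element of `ℂ[D]`. -/
def liftVec {D : Type*} [AddCommGroup D] (H : AddSubgroup D) (γ : D) : D → ℂ :=
  fun β => if β - γ ∈ H then 1 else 0

/-- `im(↑) = ∑_H im(↑_H)`, the span of all isotropic lifts over nontrivial
isotropic subgroups `H` of `D`. -/
def imUp {D : Type*} [AddCommGroup D] (q : D → AddCircle (1 : ℚ)) :
    Submodule ℂ (D → ℂ) :=
  Submodule.span ℂ
    {v | ∃ H : AddSubgroup D, H ≠ ⊥ ∧ (∀ x ∈ H, q x = 0) ∧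
      ∃ γ : D, (∀ μ ∈ H, bil q γ μ = 0) ∧ v = liftVec H γ}
section Forms

variable {D : Type*} [AddCommGroup D] {q : D → AddCircle (1 : ℚ)}

lemma bil_comm (q : D → AddCircle (1 : ℚ)) (x y : D) : bil q x y = bil q y x := by
  simp only [bil, add_comm x y]
  abel

lemma map_add_eq_add_bil (q : D → AddCircle (1 : ℚ)) (x y : D) :
    q (x + y) = q x + q y + bil q x y := by
  simp only [bil]
  abel

/-- The homomorphism `x ↦ b(x, z)`. -/
def bilHom (hbil : ∀ x y z : D, bil q (x + y) z = bil q x z + bil q y z) (z : D) :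
    D →+ AddCircle (1 : ℚ) :=
  AddMonoidHom.mk' (fun x => bil q x z) (fun x y => hbil x y z)

lemma bilHom_apply (hbil : ∀ x y z : D, bil q (x + y) z = bil q x z + bil q y z) (x z : D) :
    bilHom hbil z x = bil q x z := rfl

lemma bilHom_comm (hbil : ∀ x y z : D, bil q (x + y) z = bil q x z + bil q y z) (x z : D) :
    bilHom hbil z x = bilHom hbil x z := bil_comm q x z

lemma bil_self (hquad : ∀ (n : ℤ) (x : D), q (n • x) = (n ^ 2 : ℤ) • q x) (x : D) :
    bil q x x = (2 : ℤ) • q x := by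
  have h := hquad 2 x
  rw [two_zsmul] at h
  rw [bil, h]
  norm_num
  abel

lemma map_zero_of_quad (hquad : ∀ (n : ℤ) (x : D), q (n • x) = (n ^ 2 : ℤ) • q x) :
    q 0 = 0 := by
  simpa using hquad 0 0

end Forms

lemma eq_zero_of_isCoprime_zsmul {A : Type*} [AddCommGroup A] {m n : ℤ} (h : IsCoprime m n)
    {x : A} (hm : m • x = 0) (hn : n • x = 0) : x = 0 := by
  obtain ⟨a, b, hab⟩ := h
  rw [← one_zsmul x, ← hab, add_zsmul, mul_zsmul, mul_zsmul, hm, hn]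
  simp

lemma mem_zmultiples_of_isCoprime_zsmul {A : Type*} [AddCommGroup A] {m n : ℤ}
    (h : IsCoprime m n) {x : A} {L : AddSubgroup A} (hm : m • x ∈ L) (hn : n • x ∈ L) :
    x ∈ L := by
  obtain ⟨a, b, hab⟩ := h
  rw [← one_zsmul x, ← hab, add_zsmul, mul_zsmul, mul_zsmul]
  exact L.add_mem (L.zsmul_mem hm a) (L.zsmul_mem hn b)

lemma isCoprime_of_not_dvd {p : ℕ} (hp : p.Prime) {a : ℤ} (h : ¬ (p : ℤ) ∣ a) :
    IsCoprime a (p : ℤ) :=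
  ((Nat.prime_iff_prime_int.mp hp).coprime_iff_not_dvd.mpr h).symm

lemma isCoprime_of_zsmul_ne_zero {A : Type*} [AddCommGroup A] {p : ℕ} (hp : p.Prime)
    {x : A} (hx : (p : ℤ) • x = 0) {a : ℤ} (h : a • x ≠ 0) : IsCoprime a (p : ℤ) := by
  refine isCoprime_of_not_dvd hp fun ⟨c, hc⟩ => h ?_
  rw [hc, mul_comm, mul_zsmul, hx, zsmul_zero]

lemma mem_zmultiples_symm {A : Type*} [AddCommGroup A] {p : ℕ} (hp : p.Prime)
    {x y : A} (hx : (p : ℤ) • x = 0) (hy : y ∈ AddSubgroup.zmultiples x) (hy0 : y ≠ 0) :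
    x ∈ AddSubgroup.zmultiples y := by
  obtain ⟨a, rfl⟩ := AddSubgroup.mem_zmultiples_iff.mp hy
  refine mem_zmultiples_of_isCoprime_zsmul (isCoprime_of_zsmul_ne_zero hp hx hy0)
    (AddSubgroup.mem_zmultiples _) ?_
  rw [hx]
  exact zero_mem _

lemma addCircle_eq_zsmul_of_torsion {p : ℕ} (hp : p.Prime) {u t : AddCircle (1 : ℚ)}
    (hu : (p : ℤ) • u = 0) (ht : (p : ℤ) • t = 0) (hu0 : u ≠ 0) : ∃ s : ℤ, t = s • u := by
  have hp0 : (p : ℚ) ≠ 0 := by exact_mod_cast hp.ne_zero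
  have key : ∀ v : AddCircle (1 : ℚ), (p : ℤ) • v = 0 →
      ∃ m : ℤ, v = m • (((1 / p : ℚ)) : AddCircle (1 : ℚ)) := by
    intro v hv
    induction v using QuotientAddGroup.induction_on with
    | H x =>
      have h' : (((p : ℤ) • x : ℚ) : AddCircle (1 : ℚ)) = 0 := hv
      obtain ⟨m, hm⟩ := (AddCircle.coe_eq_zero_iff (1 : ℚ)).mp h'
      refine ⟨m, ?_⟩
      rw [← AddCircle.coe_zsmul]
      congr 1
      simp only [zsmul_eq_mul, mul_one, Int.cast_natCast] at hm ⊢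
      field_simp
      linarith
  obtain ⟨a, rfl⟩ := key u hu
  obtain ⟨c, rfl⟩ := key t ht
  have hw : (p : ℤ) • (((1 / p : ℚ)) : AddCircle (1 : ℚ)) = 0 := by
    rw [← AddCircle.coe_zsmul, AddCircle.coe_eq_zero_iff]
    exact ⟨1, by simp [hp0]⟩
  have hmem := mem_zmultiples_symm hp hw (AddSubgroup.zsmul_mem_zmultiples _ a) hu0
  obtain ⟨s, hs⟩ := AddSubgroup.mem_zmultiples_iff.mp (AddSubgroup.zsmul_mem _ hmem c)
  exact ⟨s, hs.symm⟩

/-- Two independent elements of order `p` generate a copy of `(ℤ/pℤ)²`. -/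
lemma exists_addSubgroup_equiv_prod {A : Type*} [AddCommGroup A] {p : ℕ} (hp : p.Prime)
    {x y : A} (hx : (p : ℤ) • x = 0) (hy : (p : ℤ) • y = 0) (hx0 : x ≠ 0)
    (hxy : y ∉ AddSubgroup.zmultiples x) :
    ∃ K : AddSubgroup A, (∀ z ∈ K, ∃ a b : ℤ, z = a • x + b • y) ∧
      Nonempty (K ≃+ (ZMod p × ZMod p)) := by
  let fx : ZMod p →+ A := ZMod.lift p ⟨zmultiplesHom A x, by simpa using hx⟩
  let fy : ZMod p →+ A := ZMod.lift p ⟨zmultiplesHom A y, by simpa using hy⟩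
  have hfx : ∀ a : ℤ, fx a = a • x := fun a => by simp [fx]
  have hfy : ∀ a : ℤ, fy a = a • y := fun a => by simp [fy]
  have hinj : Function.Injective (fx.coprod fy) := by
    rw [injective_iff_map_eq_zero]
    rintro ⟨a, b⟩ hab
    obtain ⟨a, rfl⟩ := ZMod.intCast_surjective a
    obtain ⟨b, rfl⟩ := ZMod.intCast_surjective b
    simp only [AddMonoidHom.coprod_apply, hfx, hfy] at hab
    have hb : (p : ℤ) ∣ b := by
      by_contra hb
      refine hxy (mem_zmultiples_of_isCoprime_zsmul (isCoprime_of_not_dvd hp hb) ?_ ?_)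
      · rw [eq_neg_of_add_eq_zero_right hab]
        exact neg_mem (AddSubgroup.zsmul_mem_zmultiples _ _)
      · rw [hy]
        exact zero_mem _
    have hby : b • y = 0 := by
      obtain ⟨c, rfl⟩ := hb
      rw [mul_comm, mul_zsmul, hy, zsmul_zero]
    have ha : (p : ℤ) ∣ a := by
      by_contra ha
      rw [hby, add_zero] at hab
      exact hx0 (eq_zero_of_isCoprime_zsmul (isCoprime_of_not_dvd hp ha) hab hx)
    rw [(ZMod.intCast_zmod_eq_zero_iff_dvd a p).mpr ha,
      (ZMod.intCast_zmod_eq_zero_iff_dvd b p).mpr hb]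
    rfl
  refine ⟨(fx.coprod fy).range, ?_, ⟨(AddMonoidHom.ofInjective hinj).symm⟩⟩
  rintro _ ⟨⟨a, b⟩, rfl⟩
  obtain ⟨a, rfl⟩ := ZMod.intCast_surjective a
  obtain ⟨b, rfl⟩ := ZMod.intCast_surjective b
  exact ⟨a, b, by simp [hfx, hfy]⟩

section Isotropic

variable {D : Type*} [AddCommGroup D] {q : D → AddCircle (1 : ℚ)}

/-- If `γ^⊥` contains no isotropic `(ℤ/pℤ)²`, then orthogonal isotropic `p`-torsion elements
of `γ^⊥` are dependent. -/
lemma mem_zmultiples_of_no_isotropic_plane {p : ℕ} (hp : p.Prime)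
    (hquad : ∀ (n : ℤ) (x : D), q (n • x) = (n ^ 2 : ℤ) • q x)
    (hbil : ∀ x y z : D, bil q (x + y) z = bil q x z + bil q y z) {γ : D}
    (hK : ¬ ∃ K : AddSubgroup D, (∀ x ∈ K, q x = 0) ∧
        (∀ x ∈ K, bil q γ x = 0) ∧ Nonempty (K ≃+ (ZMod p × ZMod p)))
    {x y : D} (hx : (p : ℤ) • x = 0) (hy : (p : ℤ) • y = 0) (hx0 : x ≠ 0)
    (hqx : q x = 0) (hqy : q y = 0) (hxy : bil q x y = 0)
    (hgx : bil q γ x = 0) (hgy : bil q γ y = 0) : y ∈ AddSubgroup.zmultiples x := by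
  by_contra hmem
  obtain ⟨K, hKm, hKe⟩ := exists_addSubgroup_equiv_prod hp hx hy hx0 hmem
  refine hK ⟨K, fun z hz => ?_, fun z hz => ?_, hKe⟩
  · obtain ⟨a, b, rfl⟩ := hKm z hz
    rw [map_add_eq_add_bil q, hquad, hquad, hqx, hqy, ← bilHom_apply hbil, map_zsmul,
      bilHom_comm, map_zsmul, bilHom_comm, bilHom_apply, hxy]
    simp
  · obtain ⟨a, b, rfl⟩ := hKm z hz
    rw [bil_comm, ← bilHom_apply hbil, map_add, map_zsmul, map_zsmul, bilHom_apply,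
      bilHom_apply, bil_comm q x, bil_comm q y, hgx, hgy]
    simp

lemma exists_torsion_of_ne_bot {p : ℕ}
    (hexp : ∃ k : ℕ, ∀ x : D, p ^ k • x = 0) {H : AddSubgroup D} (hH : H ≠ ⊥) :
    ∃ μ ∈ H, μ ≠ 0 ∧ (p : ℤ) • μ = 0 := by
  obtain ⟨x, hxH, hx0⟩ := H.bot_or_exists_ne_zero.resolve_left hH
  have hex : ∃ k : ℕ, p ^ k • x = 0 := hexp.imp fun k hk => hk x
  have hpos : Nat.find hex ≠ 0 := by
    intro h
    have := Nat.find_spec hex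
    rw [h] at this
    simp [hx0] at this
  refine ⟨p ^ (Nat.find hex - 1) • x, H.nsmul_mem hxH _,
    Nat.find_min hex (Nat.sub_one_lt hpos), ?_⟩
  rw [natCast_zsmul, ← mul_nsmul', ← pow_succ', Nat.sub_one_add_one hpos]
  exact Nat.find_spec hex

lemma bil_eq_zero_of_mem_zmultiples
    (hquad : ∀ (n : ℤ) (x : D), q (n • x) = (n ^ 2 : ℤ) • q x)
    (hbil : ∀ x y z : D, bil q (x + y) z = bil q x z + bil q y z) {μ x : D}
    (hμ : q μ = 0) (hx : x ∈ AddSubgroup.zmultiples μ) : bil q x μ = 0 := by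
  obtain ⟨a, rfl⟩ := AddSubgroup.mem_zmultiples_iff.mp hx
  rw [← bilHom_apply hbil, map_zsmul, bilHom_apply, bil_self hquad, hμ]
  simp

lemma bil_eq_zero_of_sub_mem_zmultiples
    (hquad : ∀ (n : ℤ) (x : D), q (n • x) = (n ^ 2 : ℤ) • q x)
    (hbil : ∀ x y z : D, bil q (x + y) z = bil q x z + bil q y z) {μ γ δ : D}
    (hμ : q μ = 0) (hδ : bil q δ μ = 0) (hx : γ - δ ∈ AddSubgroup.zmultiples μ) :
    bil q γ μ = 0 := by
  have h := bil_eq_zero_of_mem_zmultiples hquad hbil hμ hx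
  rwa [← bilHom_apply hbil, map_sub, bilHom_apply, bilHom_apply, hδ, sub_zero] at h

/-- The isotropic `p`-torsion elements orthogonal to `γ`. -/
def isoTorsion (q : D → AddCircle (1 : ℚ)) (p : ℕ) (γ : D) : Set D :=
  {v | (p : ℤ) • v = 0 ∧ q v = 0 ∧ bil q γ v = 0}

/-- The functional `p e^γ - ∑ e^{γ+v}`, with `v` running through `isoTorsion q p γ`. -/
def coneFun (q : D → AddCircle (1 : ℚ)) (p : ℕ) (γ : D) (x : D) : ℂ :=
  (p : ℂ) * (if x = γ then 1 else 0) - (if x - γ ∈ isoTorsion q p γ then 1 else 0)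

lemma add_mem_isoTorsion_iff {p : ℕ}
    (hquad : ∀ (n : ℤ) (x : D), q (n • x) = (n ^ 2 : ℤ) • q x)
    (hbil : ∀ x y z : D, bil q (x + y) z = bil q x z + bil q y z) {γ μ w l : D}
    (hpμ : (p : ℤ) • μ = 0) (hqμ : q μ = 0) (hγμ : bil q γ μ = 0) (hwμ : bil q w μ = 0)
    (hl : l ∈ AddSubgroup.zmultiples μ) :
    w + l ∈ isoTorsion q p γ ↔ w ∈ isoTorsion q p γ := by
  obtain ⟨a, rfl⟩ := AddSubgroup.mem_zmultiples_iff.mp hl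
  have h1 : (p : ℤ) • (w + a • μ) = (p : ℤ) • w := by
    rw [zsmul_add, smul_comm, hpμ, zsmul_zero, add_zero]
  have hb : ∀ z, bil q z μ = 0 → bil q z (a • μ) = 0 := fun z hz => by
    rw [← bilHom_apply hbil, bilHom_comm, map_zsmul, bilHom_comm, bilHom_apply, hz, zsmul_zero]
  have h2 : q (w + a • μ) = q w := by
    rw [map_add_eq_add_bil q, hb w hwμ, hquad, hqμ, zsmul_zero, add_zero, add_zero]
  have h3 : bil q γ (w + a • μ) = bil q γ w := by
    rw [bil_comm, hbil, bil_comm q _ γ, bil_comm q _ γ, hb γ hγμ, add_zero]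
  simp only [isoTorsion, Set.mem_ofPred_eq, h1, h2, h3]

lemma coneFun_self {p : ℕ} (hp : p.Prime)
    (hquad : ∀ (n : ℤ) (x : D), q (n • x) = (n ^ 2 : ℤ) • q x)
    (hbil : ∀ x y z : D, bil q (x + y) z = bil q x z + bil q y z) (γ : D) :
    coneFun q p γ γ ≠ 0 := by
  have h0 : (0 : D) ∈ isoTorsion q p γ := ⟨zsmul_zero _, map_zero_of_quad hquad,
    by rw [bil_comm, ← bilHom_apply hbil, map_zero]⟩
  simp only [coneFun, sub_self, h0, if_true, mul_one]
  rw [sub_ne_zero]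
  exact_mod_cast hp.one_lt.ne'

variable [Fintype D]

lemma sum_subgroup_eq_zero_of_le {H L : AddSubgroup D} (hLH : L ≤ H) (f : D → ℂ) (δ : D)
    (h : ∀ x ∈ H, ∑ l : L, f (δ + x + l) = 0) : ∑ x : H, f (δ + x) = 0 := by
  have hshift : ∀ l : L, ∑ x : H, f (δ + x + l) = ∑ x : H, f (δ + x) := by
    intro l
    refine Fintype.sum_equiv (Equiv.addRight (⟨l, hLH l.2⟩ : H)) _ _ fun x => ?_
    simp [add_assoc]
  have hcomm : ∑ l : L, ∑ x : H, f (δ + x + l) = 0 := by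
    rw [Finset.sum_comm]
    exact Finset.sum_eq_zero fun x _ => h x x.2
  simp only [hshift, Finset.sum_const, Finset.card_univ, nsmul_eq_mul] at hcomm
  exact (mul_eq_zero.mp hcomm).resolve_left (by exact_mod_cast Fintype.card_ne_zero)

lemma sum_mul_liftVec (H : AddSubgroup D) (f : D → ℂ) (δ : D) :
    ∑ β, f β * liftVec H δ β = ∑ x : H, f (δ + x) := by
  rw [← Fintype.sum_equiv (Equiv.addLeft δ) (fun x => if x ∈ H then f (δ + x) else 0) _
    (fun x => by simp [liftVec]), ← Finset.sum_filter]
  exact Finset.sum_subtype _ (by simp) (fun x => f (δ + x))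

/-- A functional killing the lifts along all isotropic subgroups of order `p` kills `imUp q`. -/
lemma eV_notMem_imUp {p : ℕ}
    (hbil : ∀ x y z : D, bil q (x + y) z = bil q x z + bil q y z)
    (hexp : ∃ k : ℕ, ∀ x : D, p ^ k • x = 0) {γ : D} (f : D → ℂ) (hf : f γ ≠ 0)
    (h : ∀ μ : D, μ ≠ 0 → (p : ℤ) • μ = 0 → q μ = 0 → ∀ δ : D, bil q δ μ = 0 →
      ∑ l : AddSubgroup.zmultiples μ, f (δ + l) = 0) : eV γ ∉ imUp q := by
  intro hmem
  let φ : (D → ℂ) →ₗ[ℂ] ℂ := Fintype.linearCombination ℂ f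
  have hφ : ∀ v, φ v = ∑ β, f β * v β := fun v => by
    simp [φ, Fintype.linearCombination_apply, mul_comm]
  have hle : imUp q ≤ LinearMap.ker φ := by
    refine Submodule.span_le.mpr ?_
    rintro _ ⟨H, hH, hiso, δ, hδ, rfl⟩
    obtain ⟨μ, hμH, hμ0, hpμ⟩ := exists_torsion_of_ne_bot hexp hH
    rw [SetLike.mem_coe, LinearMap.mem_ker, hφ, sum_mul_liftVec]
    refine sum_subgroup_eq_zero_of_le ((AddSubgroup.zmultiples_le_of_mem) hμH) f δ
      fun x hx => h μ hμ0 hpμ (hiso μ hμH) _ ?_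
    rw [hbil, hδ μ hμH, bil, hiso _ (H.add_mem hx hμH), hiso x hx, hiso μ hμH]
    simp
  have := hle hmem
  rw [LinearMap.mem_ker, hφ] at this
  simp [eV] at this
  exact hf this

lemma sum_ite_add_eq (L : AddSubgroup D) (δ γ : D) :
    ∑ l : L, (if δ + l = γ then (1 : ℂ) else 0) = if γ - δ ∈ L then 1 else 0 := by
  split_ifs with h
  · rw [Finset.sum_eq_single (⟨γ - δ, h⟩ : L)]
    · simp
    · intro l _ hl
      refine if_neg fun h' => hl (Subtype.ext ?_)
      simp [← h']
    · simp
  · refine Finset.sum_eq_zero fun l _ => if_neg fun h' => h ?_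
    simp [← h']

/-- The case where an isotropic multiple of `γ` of order `p` is orthogonal to `γ`. -/
lemma eV_notMem_imUp_of_isotropic_multiple {p : ℕ} (hp : p.Prime)
    (hquad : ∀ (n : ℤ) (x : D), q (n • x) = (n ^ 2 : ℤ) • q x)
    (hbil : ∀ x y z : D, bil q (x + y) z = bil q x z + bil q y z)
    (hexp : ∃ k : ℕ, ∀ x : D, p ^ k • x = 0) {γ : D}
    (hK : ¬ ∃ K : AddSubgroup D, (∀ x ∈ K, q x = 0) ∧
        (∀ x ∈ K, bil q γ x = 0) ∧ Nonempty (K ≃+ (ZMod p × ZMod p)))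
    {c : ℤ} (hc : IsCoprime (1 + c) (p : ℤ)) (hc0 : c • γ ≠ 0) (hpc : (p : ℤ) • c • γ = 0)
    (hqc : q (c • γ) = 0) (hbc : bil q γ (c • γ) = 0) : eV γ ∉ imUp q := by
  refine eV_notMem_imUp hbil hexp
    (fun x => (if x = γ then 1 else 0) - (if x = γ + c • γ then 1 else 0)) (by simp [hc0]) ?_
  intro μ hμ0 hpμ hqμ δ hδ
  rw [Finset.sum_sub_distrib, sum_ite_add_eq, sum_ite_add_eq, sub_eq_zero]
  have key : bil q γ μ = 0 → c • γ ∈ AddSubgroup.zmultiples μ := fun hγμ =>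
    mem_zmultiples_of_no_isotropic_plane hp hquad hbil hK hpμ hpc hμ0 hqμ hqc
      (by rw [bil_comm, ← bilHom_apply hbil, map_zsmul, bilHom_apply, hγμ, zsmul_zero]) hγμ hbc
  refine if_congr ⟨fun h => ?_, fun h => ?_⟩ rfl rfl
  · have := key (bil_eq_zero_of_sub_mem_zmultiples hquad hbil hqμ hδ h)
    rw [add_sub_right_comm]
    exact add_mem h this
  · have h1 := bil_eq_zero_of_sub_mem_zmultiples hquad hbil hqμ hδ h
    have h2 : bil q γ μ = 0 := by
      refine eq_zero_of_isCoprime_zsmul hc ?_ ?_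
      · rw [add_zsmul, one_zsmul]
        rwa [← bilHom_apply hbil, map_add, map_zsmul] at h1
      · rw [← bilHom_apply hbil, bilHom_comm, ← map_zsmul, hpμ, map_zero]
    rw [add_sub_right_comm] at h
    exact (AddSubgroup.add_mem_cancel_right _ (key h2)).mp h

lemma sum_coneFun_eq_zero {p : ℕ} (hp : p.Prime)
    (hquad : ∀ (n : ℤ) (x : D), q (n • x) = (n ^ 2 : ℤ) • q x)
    (hbil : ∀ x y z : D, bil q (x + y) z = bil q x z + bil q y z) {γ : D}
    (hK : ¬ ∃ K : AddSubgroup D, (∀ x ∈ K, q x = 0) ∧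
        (∀ x ∈ K, bil q γ x = 0) ∧ Nonempty (K ≃+ (ZMod p × ZMod p)))
    {μ δ : D} (hμ0 : μ ≠ 0) (hpμ : (p : ℤ) • μ = 0) (hqμ : q μ = 0)
    (hδ : bil q δ μ = 0) (hγμ : bil q γ μ = 0) :
    ∑ l : AddSubgroup.zmultiples μ, coneFun q p γ (δ + l) = 0 := by
  have hwμ : bil q (δ - γ) μ = 0 := by
    rw [← bilHom_apply hbil, map_sub, bilHom_apply, bilHom_apply, hδ, hγμ, sub_zero]
  have hcard : Fintype.card (AddSubgroup.zmultiples μ) = p := by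
    have : Fact p.Prime := ⟨hp⟩
    rw [Fintype.card_zmultiples]
    exact addOrderOf_eq_prime (by rwa [natCast_zsmul] at hpμ) hμ0
  have hiff : ∀ l : AddSubgroup.zmultiples μ,
      (δ + l - γ ∈ isoTorsion q p γ ↔ δ - γ ∈ isoTorsion q p γ) := fun l => by
    rw [add_sub_right_comm]
    exact add_mem_isoTorsion_iff hquad hbil hpμ hqμ hγμ hwμ l.2
  have hline : γ - δ ∈ AddSubgroup.zmultiples μ ↔ δ - γ ∈ isoTorsion q p γ := by
    rw [← neg_mem_iff, neg_sub]
    constructor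
    · intro h
      rw [← zero_add (δ - γ), add_mem_isoTorsion_iff hquad hbil hpμ hqμ hγμ
        (bil_eq_zero_of_mem_zmultiples hquad hbil hqμ (zero_mem _)) h]
      exact ⟨zsmul_zero _, map_zero_of_quad hquad,
        by rw [bil_comm, ← bilHom_apply hbil, map_zero]⟩
    · rintro ⟨h1, h2, h3⟩
      exact mem_zmultiples_of_no_isotropic_plane hp hquad hbil hK hpμ h1 hμ0 hqμ h2
        (by rwa [bil_comm]) hγμ h3
  simp only [coneFun, hiff]
  rw [Finset.sum_sub_distrib, ← Finset.mul_sum, sum_ite_add_eq, Finset.sum_const,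
    Finset.card_univ, hcard]
  simp only [hline]
  split_ifs <;> simp

lemma eV_zero_notMem_imUp {p : ℕ} (hp : p.Prime)
    (hquad : ∀ (n : ℤ) (x : D), q (n • x) = (n ^ 2 : ℤ) • q x)
    (hbil : ∀ x y z : D, bil q (x + y) z = bil q x z + bil q y z)
    (hexp : ∃ k : ℕ, ∀ x : D, p ^ k • x = 0)
    (hK : ¬ ∃ K : AddSubgroup D, (∀ x ∈ K, q x = 0) ∧
        (∀ x ∈ K, bil q 0 x = 0) ∧ Nonempty (K ≃+ (ZMod p × ZMod p))) :
    eV (0 : D) ∉ imUp q :=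
  eV_notMem_imUp hbil hexp (coneFun q p 0) (coneFun_self hp hquad hbil 0)
    fun μ hμ0 hpμ hqμ δ hδ => sum_coneFun_eq_zero hp hquad hbil hK hμ0 hpμ hqμ hδ
      (by rw [← bilHom_apply hbil, map_zero])

/-- The case of an anisotropic `γ` of order `p`. -/
lemma eV_notMem_imUp_of_anisotropic {p : ℕ} (hp : p.Prime) (hodd : p ≠ 2)
    (hquad : ∀ (n : ℤ) (x : D), q (n • x) = (n ^ 2 : ℤ) • q x)
    (hbil : ∀ x y z : D, bil q (x + y) z = bil q x z + bil q y z)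
    (hexp : ∃ k : ℕ, ∀ x : D, p ^ k • x = 0) {γ : D}
    (hK : ¬ ∃ K : AddSubgroup D, (∀ x ∈ K, q x = 0) ∧
        (∀ x ∈ K, bil q γ x = 0) ∧ Nonempty (K ≃+ (ZMod p × ZMod p)))
    (hpγ : (p : ℤ) • γ = 0) (hqγ : q γ ≠ 0) : eV γ ∉ imUp q := by
  have hneg : ∀ z x : D, bil q (-z) x = 0 ↔ bil q z x = 0 := fun z x => by
    rw [← bilHom_apply hbil, map_neg, neg_eq_zero, bilHom_apply]
  have hqneg : q (-γ) = q γ := by simpa using hquad (-1) γ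
  have hcop : IsCoprime (4 : ℤ) ((p : ℤ) ^ 2) := by
    have : IsCoprime (2 : ℤ) (p : ℤ) := by
      refine isCoprime_of_not_dvd hp fun h => hodd ?_
      exact (Nat.prime_dvd_prime_iff_eq hp Nat.prime_two).mp (by exact_mod_cast h)
    simpa using this.pow (m := 2) (n := 2)
  have h4 : (4 : ℤ) • q γ ≠ 0 := fun h => by
    refine hqγ (eq_zero_of_isCoprime_zsmul hcop h ?_)
    rw [← hquad, hpγ, map_zero_of_quad hquad]
  have hval : coneFun q p (-γ) γ = 0 := by
    have h1 : γ ≠ -γ := fun h => h4 <| by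
      have := hquad 2 γ
      rw [two_zsmul] at this
      nth_rewrite 1 [h] at this
      rw [neg_add_cancel, map_zero_of_quad hquad] at this
      exact this.symm
    have h2 : γ - -γ ∉ isoTorsion q p (-γ) := fun h => h4 <| by
      have := (hneg _ _).mp h.2.2
      rw [sub_neg_eq_add, bil_comm, hbil, bil_self hquad] at this
      rw [← this, ← add_zsmul]
      norm_num
    simp only [coneFun, if_neg h1, if_neg h2, mul_zero, sub_zero]
  refine eV_notMem_imUp hbil hexp (fun x => coneFun q p γ x - coneFun q p (-γ) x)
    (by simpa [hval] using coneFun_self hp hquad hbil γ) ?_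
  intro μ hμ0 hpμ hqμ δ hδ
  rw [Finset.sum_sub_distrib]
  by_cases hγμ : bil q γ μ = 0
  · rw [sum_coneFun_eq_zero hp hquad hbil hK hμ0 hpμ hqμ hδ hγμ,
      sum_coneFun_eq_zero hp hquad hbil (by simpa only [hneg] using hK) hμ0 hpμ hqμ hδ
        ((hneg _ _).mpr hγμ), sub_zero]
  have hm1 : γ - δ ∉ AddSubgroup.zmultiples μ := fun h =>
    hγμ (bil_eq_zero_of_sub_mem_zmultiples hquad hbil hqμ hδ h)
  have hm2 : -γ - δ ∉ AddSubgroup.zmultiples μ := fun h =>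
    hγμ ((hneg _ _).mp (bil_eq_zero_of_sub_mem_zmultiples hquad hbil hqμ hδ h))
  simp only [coneFun]
  rw [Finset.sum_sub_distrib, Finset.sum_sub_distrib, ← Finset.mul_sum, ← Finset.mul_sum,
    sum_ite_add_eq, sum_ite_add_eq, if_neg hm1, if_neg hm2, mul_zero, zero_sub, zero_sub,
    sub_eq_zero, neg_inj]
  obtain ⟨s, hs⟩ := addCircle_eq_zsmul_of_torsion hp (u := bil q γ μ)
    (t := -((2 : ℤ) • bil q γ γ))
    (by rw [← bilHom_apply hbil, ← map_zsmul, hpγ, map_zero])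
    (by rw [← bilHom_apply hbil, zsmul_neg, smul_comm, ← map_zsmul, hpγ, map_zero]; simp) hγμ
  refine Fintype.sum_equiv (Equiv.addRight
    (⟨s • μ, AddSubgroup.zsmul_mem_zmultiples μ s⟩ : AddSubgroup.zmultiples μ)) _ _ fun l => ?_
  refine if_congr ?_ rfl rfl
  have hxμ : bil q (δ + l) (s • μ) = 0 := by
    rw [bil_comm, ← bilHom_apply hbil, map_zsmul, bilHom_apply, bil_comm, hbil, hδ,
      bil_eq_zero_of_mem_zmultiples hquad hbil hqμ l.2]
    simp
  have hqx : q (δ + l + s • μ) = q (δ + l) := by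
    rw [map_add_eq_add_bil q, hxμ, hquad, hqμ, zsmul_zero, add_zero, add_zero]
  simp only [Equiv.coe_addRight, AddSubgroup.coe_add, ← add_assoc]
  generalize δ + (l : D) = x at hxμ hqx ⊢
  have h1 : (p : ℤ) • (x + s • μ - -γ) = (p : ℤ) • (x - γ) := by
    rw [zsmul_sub, zsmul_add, smul_comm, hpμ, zsmul_neg, hpγ, zsmul_sub, hpγ]
    simp
  have h3 : bil q γ (x + s • μ - -γ) = bil q γ (x - γ) := by
    rw [← bilHom_apply hbil, ← bilHom_apply hbil, bilHom_comm, bilHom_comm hbil γ (x - γ),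
      map_sub, map_add, map_sub, map_zsmul, map_neg, bilHom_apply hbil μ, bil_comm q μ γ, ← hs,
      bilHom_apply hbil γ γ, two_zsmul]
    abel
  have h2 : bil q γ (x - γ) = 0 → q (x + s • μ - -γ) = q (x - γ) := by
    intro h
    have e1 := map_add_eq_add_bil q γ (x - γ)
    have e2 := map_add_eq_add_bil q (-γ) (x + s • μ - -γ)
    rw [add_sub_cancel, h, add_zero] at e1
    rw [add_sub_cancel, (hneg _ _).mpr (h3.trans h), add_zero, hqneg, hqx, e1] at e2
    exact (add_left_cancel e2).symm
  simp only [isoTorsion, Set.mem_ofPred_eq, hneg, h1, h3]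
  constructor
  · rintro ⟨a, b, c⟩
    exact ⟨a, (h2 c).trans b, c⟩
  · rintro ⟨a, b, c⟩
    exact ⟨a, (h2 c).symm.trans b, c⟩

/-- Inclusion-exclusion over the cyclic subgroups of `K ≅ (ℤ/pℤ)²`. -/
lemma eV_mem_imUp_of_isotropic_plane {p : ℕ} (hp : p.Prime) {γ : D} {K : AddSubgroup D}
    (hq : ∀ x ∈ K, q x = 0) (hγ : ∀ x ∈ K, bil q γ x = 0) (e : K ≃+ (ZMod p × ZMod p)) :
    eV γ ∈ imUp q := by
  have : Fact p.Prime := ⟨hp⟩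
  have hcard : Fintype.card K = p ^ 2 := by
    rw [Fintype.card_congr e.toEquiv, Fintype.card_prod, ZMod.card, sq]
  have htor : ∀ x ∈ K, (p : ℤ) • x = 0 := by
    intro x hx
    have h : (p : ℤ) • (⟨x, hx⟩ : K) = 0 := by
      apply e.injective
      rw [map_zsmul, map_zero]
      ext <;> simp
    simpa using congrArg Subtype.val h
  have hlift : ∀ H : AddSubgroup D, H ≠ ⊥ → H ≤ K → liftVec H γ ∈ imUp q := fun H hH hHK =>
    Submodule.subset_span ⟨H, hH, fun x hx => hq x (hHK hx), γ, fun x hx => hγ x (hHK hx), rfl⟩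
  have hKbot : K ≠ ⊥ := by
    intro h
    rw [← Nat.card_eq_fintype_card, h, AddSubgroup.card_bot] at hcard
    exact (Nat.one_lt_pow two_ne_zero hp.one_lt).ne hcard
  let S : Finset D := {k | k ∈ K ∧ k ≠ 0}
  have hScard : S.card = p ^ 2 - 1 := by
    have h1 : S = ({k | k ∈ K} : Finset D).erase 0 := by
      ext k
      simp [S, and_comm]
    rw [h1, Finset.card_erase_of_mem (by simp), ← hcard, Fintype.card_subtype]
  have hsum : (∑ k ∈ S, liftVec (AddSubgroup.zmultiples k) γ) - ((p : ℂ) - 1) • liftVec K γ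
      = ((p : ℂ) ^ 2 - p) • eV γ := by
    ext β
    simp only [Pi.sub_apply, Finset.sum_apply, Pi.smul_apply, smul_eq_mul, liftVec, eV]
    by_cases hβ : β = γ
    · subst hβ
      simp only [sub_self, zero_mem, if_true, Finset.sum_const, hScard, nsmul_eq_mul, mul_one]
      rw [Nat.cast_sub (Nat.one_le_pow _ _ hp.pos)]
      push_cast
      ring
    · rw [if_neg hβ, mul_zero, sub_eq_zero]
      have hw0 : β - γ ≠ 0 := sub_ne_zero.mpr hβ
      generalize β - γ = w at hw0 ⊢
      by_cases hw : w ∈ K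
      · rw [if_pos hw, mul_one, Finset.sum_boole]
        have h1 : {k ∈ S | w ∈ AddSubgroup.zmultiples k} =
            ({k | k ∈ AddSubgroup.zmultiples w} : Finset D).erase 0 := by
          ext k
          simp only [S, Finset.mem_filter, Finset.mem_univ, true_and, Finset.mem_erase]
          constructor
          · rintro ⟨⟨hk, hk0⟩, hwk⟩
            exact ⟨hk0, mem_zmultiples_symm hp (htor k hk) hwk hw0⟩
          · rintro ⟨hk0, hkw⟩
            exact ⟨⟨AddSubgroup.zmultiples_le_of_mem hw hkw, hk0⟩,
              mem_zmultiples_symm hp (htor w hw) hkw hk0⟩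
        rw [h1, Finset.card_erase_of_mem (by simp), ← Fintype.card_subtype]
        have h2 : Fintype.card (AddSubgroup.zmultiples w) = p := by
          rw [Fintype.card_zmultiples]
          exact addOrderOf_eq_prime (by simpa using htor w hw) hw0
        rw [show Fintype.card {x // x ∈ AddSubgroup.zmultiples w} = p by convert h2,
          Nat.cast_sub hp.pos, Nat.cast_one]
      · rw [if_neg hw, mul_zero]
        refine Finset.sum_eq_zero fun k hk => if_neg fun hwk => hw ?_
        exact AddSubgroup.zmultiples_le_of_mem (Finset.mem_filter.mp hk).2.1 hwk
  have hne : (p : ℂ) ^ 2 - p ≠ 0 := by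
    rw [sub_ne_zero]
    exact_mod_cast (lt_self_pow₀ hp.one_lt one_lt_two).ne'
  rw [← Submodule.smul_mem_iff _ hne, ← hsum]
  refine Submodule.sub_mem _ (Submodule.sum_mem _ fun k hk => ?_)
    (Submodule.smul_mem _ _ (hlift K hKbot le_rfl))
  have hk' := (Finset.mem_filter.mp hk).2
  exact hlift _ (by simpa using hk'.2) (AddSubgroup.zmultiples_le_of_mem hk'.1)

end Isotropic

/-- Let `D` be a discriminant form of exponent a power of an odd prime `p` and
let `γ ∈ D` have order `n` with `q(γ) = j/n mod 1`, where either `n ≤ p` or `p`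
divides `j`.  Then `e^γ ∈ im(↑)` if and only if `γ^⊥` contains an isotropic
subgroup isomorphic to `(ℤ/pℤ)²`. -/
theorem basisVec_mem_imUp_iff_isotropic_rank_two
    {D : Type*} [AddCommGroup D] [Fintype D] (p : ℕ) (hp : p.Prime) (hodd : p ≠ 2)
    (q : D → AddCircle (1 : ℚ))
    (hquad : ∀ (n : ℤ) (x : D), q (n • x) = (n ^ 2 : ℤ) • q x)
    (hbil : ∀ x y z : D, bil q (x + y) z = bil q x z + bil q y z)
    (hnd : ∀ x : D, (∀ y : D, bil q x y = 0) → x = 0)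
    (hexp : ∃ k : ℕ, ∀ x : D, p ^ k • x = 0)
    (γ : D)
    (hj : ∃ j : ℤ, q γ = (((j : ℚ) / (addOrderOf γ : ℚ) : ℚ) : AddCircle (1 : ℚ)) ∧
      (addOrderOf γ ≤ p ∨ (p : ℤ) ∣ j)) :
    eV γ ∈ imUp q ↔
      ∃ K : AddSubgroup D, (∀ x ∈ K, q x = 0) ∧
        (∀ x ∈ K, bil q γ x = 0) ∧ Nonempty (K ≃+ (ZMod p × ZMod p)) := by
  refine ⟨fun hmem => ?_, fun ⟨K, hq, hγ, ⟨e⟩⟩ => eV_mem_imUp_of_isotropic_plane hp hq hγ e⟩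
  by_contra hK
  revert hmem
  obtain ⟨k, hk⟩ := hexp
  obtain ⟨r, -, hr⟩ := (Nat.dvd_prime_pow hp).mp (addOrderOf_dvd_of_nsmul_eq_zero (hk γ))
  have hexp : ∃ k : ℕ, ∀ x : D, p ^ k • x = 0 := ⟨k, hk⟩
  have hpr : p ^ r • γ = 0 := hr ▸ addOrderOf_nsmul_eq_zero γ
  obtain ⟨j, hqj, hj⟩ := hj
  rcases r with _ | _ | r
  · obtain rfl : γ = 0 := by simpa using hpr
    exact eV_zero_notMem_imUp hp hquad hbil hexp hK
  · have hpγ : (p : ℤ) • γ = 0 := by simpa using hpr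
    have hγ0 : γ ≠ 0 := by
      rintro rfl
      simp at hr
      exact hp.one_lt.ne hr
    by_cases hqγ : q γ = 0
    · refine eV_notMem_imUp_of_isotropic_multiple hp hquad hbil hexp hK (c := 1) ?_
        (by simpa using hγ0) (by simpa using hpγ) (by simpa using hqγ)
        (by rw [one_zsmul, bil_self hquad, hqγ, zsmul_zero])
      refine isCoprime_of_not_dvd hp fun h => hodd ?_
      exact (Nat.prime_dvd_prime_iff_eq hp Nat.prime_two).mp (by exact_mod_cast h)
    · exact eV_notMem_imUp_of_anisotropic hp hodd hquad hbil hexp hK hpγ hqγ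
  · have hpj : (p : ℤ) ∣ j := by
      refine hj.resolve_left ?_
      rw [hr, not_le]
      exact lt_self_pow₀ hp.one_lt (by omega)
    obtain ⟨i, rfl⟩ := hpj
    have hp0 : (p : ℚ) ≠ 0 := by exact_mod_cast hp.ne_zero
    have hq0 : ((p ^ (r + 1) : ℕ) : ℤ) • q γ = 0 := by
      rw [hqj, hr, ← AddCircle.coe_zsmul, AddCircle.coe_eq_zero_iff]
      refine ⟨i, ?_⟩
      simp only [zsmul_eq_mul]
      push_cast
      field_simp
      ring
    refine eV_notMem_imUp_of_isotropic_multiple hp hquad hbil hexp hK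
      (c := ((p ^ (r + 1) : ℕ) : ℤ)) ?_ ?_ ?_ ?_ ?_
    · refine ⟨1, -((p : ℤ) ^ r), ?_⟩
      push_cast
      ring
    · rw [natCast_zsmul]
      intro h
      have := addOrderOf_dvd_of_nsmul_eq_zero h
      rw [hr] at this
      have := (Nat.pow_dvd_pow_iff_le_right hp.one_lt).mp this
      omega
    · rw [natCast_zsmul, natCast_zsmul, ← mul_nsmul', ← pow_succ']
      exact hpr
    · rw [hquad, sq, mul_zsmul, hq0, zsmul_zero]
    · rw [bil_comm, ← bilHom_apply hbil, map_zsmul, bilHom_apply, bil_self hquad, smul_comm, hq0,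
        zsmul_zero]
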